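/- Let K and L be n×n symmetric matrices over the field ℚ(μ) of rational functions in one variable over ℚ. Then K and L are similar over ℚ(μ) if and only if they have the same characteristic polynomial det(tI − K) = det(tI − L) over ℚ(μ). -/

import Mathlib

open Polynomial

namespace Polynomial

variable {F : Type*} [Field F]

/-- The action of the indeterminate on an `F[X]`-module, as an `F`-linear endomorphism. -/
noncomputable abbrev smulX (F M : Type*) [Field F] [AddCommGroup M] [Module F M] [Module F[X] M]
    [IsScalarTower F F[X] M] : Module.End F M :=
  Algebra.lsmul F F M (X : F[X])

section

variable {M N : Type*} [AddCommGroup M] [Module F M] [Module F[X] M] [IsScalarTower F F[X] M]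
  [FiniteDimensional F M] [AddCommGroup N] [Module F N] [Module F[X] N] [IsScalarTower F F[X] N]
  [FiniteDimensional F N]

theorem charpoly_smulX_smul (m : M) : (smulX F M).charpoly • m = 0 := by
  have h := LinearMap.aeval_self_charpoly (smulX F M)
  rw [aeval_algHom_apply, aeval_X_left_apply] at h
  exact LinearMap.congr_fun h m

theorem charpoly_smulX_eq_of_equiv (e : M ≃ₗ[F[X]] N) :
    (smulX F M).charpoly = (smulX F N).charpoly := by
  rw [← LinearEquiv.charpoly_conj (e.restrictScalars F)]
  congr 1
  ext x
  simp [LinearEquiv.conj_apply]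

theorem charpoly_smulX_prod :
    (smulX F (M × N)).charpoly = (smulX F M).charpoly * (smulX F N).charpoly := by
  rw [← LinearMap.charpoly_prodMap]
  rfl

instance finiteDimensional_submodule (S : Submodule F[X] M) : FiniteDimensional F S :=
  Module.Finite.of_injective (S.subtype.restrictScalars F) Subtype.val_injective

theorem charpoly_smulX_eq_mul_of_isCompl {S T : Submodule F[X] M} (h : IsCompl S T) :
    (smulX F M).charpoly = (smulX F S).charpoly * (smulX F T).charpoly := by
  rw [← charpoly_smulX_prod]
  exact (charpoly_smulX_eq_of_equiv (Submodule.prodEquivOfIsCompl S T h)).symm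

theorem finrank_lt_of_isCompl_of_isSimpleModule {S T : Submodule F[X] M} (h : IsCompl S T)
    [IsSimpleModule F[X] S] : Module.finrank F T < Module.finrank F M := by
  have := IsSimpleModule.nontrivial F[X] S
  have h₁ := ((Submodule.prodEquivOfIsCompl S T h).restrictScalars F).finrank_eq
  rw [Module.finrank_prod] at h₁
  have := Module.finrank_pos (R := F) (M := S)
  omega

variable (F M) in
theorem irreducible_charpoly_smulX_and_nonempty_equiv [IsSimpleModule F[X] M] :
    Irreducible (smulX F M).charpoly ∧
      Nonempty (M ≃ₗ[F[X]] F[X] ⧸ Ideal.span {(smulX F M).charpoly}) := by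
  obtain ⟨I, hI, ⟨e⟩⟩ := isSimpleModule_iff_quot_maximal.mp ‹IsSimpleModule F[X] M›
  obtain ⟨p, rfl⟩ : ∃ p, I = Ideal.span {p} := IsPrincipalIdealRing.principal I |>.principal
  have hdvd : p ∣ (smulX F M).charpoly := by
    rw [← Ideal.mem_span_singleton, ← Ideal.Quotient.eq_zero_iff_mem]
    have h := congrArg e (charpoly_smulX_smul (F := F) (e.symm 1))
    rw [map_smul, map_zero, e.apply_symm_apply] at h
    rw [← h]
    exact (congrArg (Ideal.Quotient.mk _) (mul_one _)).symm
  have hne : (smulX F M).charpoly ≠ 0 := (LinearMap.charpoly_monic _).ne_zero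
  have hp : p ≠ 0 := ne_zero_of_dvd_ne_zero hne hdvd
  have hdeg : (smulX F M).charpoly.natDegree = p.natDegree := by
    rw [LinearMap.charpoly_natDegree, (e.restrictScalars F).finrank_eq,
      finrank_quotient_span_eq_natDegree]
  have hassoc : Associated p (smulX F M).charpoly :=
    associated_of_dvd_of_natDegree_le hdvd hne hdeg.le
  have hprime : Prime p := (Ideal.span_singleton_prime hp).mp hI.isPrime
  rw [← Ideal.span_singleton_eq_span_singleton.mpr hassoc]
  exact ⟨hassoc.irreducible hprime.irreducible, ⟨e⟩⟩

theorem nonempty_equiv_of_charpoly_smulX_eq_of_isSimpleModule [IsSimpleModule F[X] M]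
    [IsSimpleModule F[X] N] (h : (smulX F M).charpoly = (smulX F N).charpoly) :
    Nonempty (M ≃ₗ[F[X]] N) := by
  obtain ⟨-, ⟨e⟩⟩ := irreducible_charpoly_smulX_and_nonempty_equiv F M
  obtain ⟨-, ⟨e'⟩⟩ := irreducible_charpoly_smulX_and_nonempty_equiv F N
  rw [h] at e
  exact ⟨e.trans e'.symm⟩

end

/-- Every irreducible monic factor of the characteristic polynomial of a semisimple module is the
characteristic polynomial of a simple submodule. -/
theorem exists_isSimpleModule_charpoly_smulX_eq {q : F[X]} (hq : Irreducible q) (hqm : q.Monic)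
    (N : Type*) [AddCommGroup N] [Module F N] [Module F[X] N] [IsScalarTower F F[X] N]
    [FiniteDimensional F N] [IsSemisimpleModule F[X] N] (hdvd : q ∣ (smulX F N).charpoly) :
    ∃ T : Submodule F[X] N, IsSimpleModule F[X] T ∧ (smulX F T).charpoly = q := by
  induction hd : Module.finrank F N using Nat.strong_induction_on generalizing N with
  | _ d ih =>
    rcases subsingleton_or_nontrivial N with hN | hN
    · have h := LinearMap.charpoly_natDegree (smulX F N)
      rw [Module.finrank_zero_of_subsingleton,
        (LinearMap.charpoly_monic _).natDegree_eq_zero] at h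
      exact absurd (isUnit_of_dvd_one (h ▸ hdvd)) hq.not_isUnit
    · obtain ⟨S, hS⟩ := IsSemisimpleModule.exists_simple_submodule F[X] N
      obtain ⟨C, hC⟩ := exists_isCompl S
      rw [charpoly_smulX_eq_mul_of_isCompl hC] at hdvd
      rcases hq.prime.dvd_or_dvd hdvd with h | h
      · refine ⟨S, hS, eq_of_monic_of_associated (LinearMap.charpoly_monic _) hqm ?_⟩
        exact (hq.associated_of_dvd
          (irreducible_charpoly_smulX_and_nonempty_equiv F S).1 h).symm
      · obtain ⟨T, hT, rfl⟩ := ih _ (hd ▸ finrank_lt_of_isCompl_of_isSimpleModule hC) C h rfl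
        let e := Submodule.equivMapOfInjective C.subtype Subtype.val_injective T
        exact ⟨T.map C.subtype, IsSimpleModule.congr (N := T) e.symm,
          (charpoly_smulX_eq_of_equiv e).symm⟩

/-- Finite-dimensional semisimple `F[X]`-modules are determined by their characteristic
polynomials. -/
theorem nonempty_equiv_of_charpoly_smulX_eq
    (M N : Type*) [AddCommGroup M] [Module F M] [Module F[X] M] [IsScalarTower F F[X] M]
    [FiniteDimensional F M] [IsSemisimpleModule F[X] M]
    [AddCommGroup N] [Module F N] [Module F[X] N] [IsScalarTower F F[X] N]
    [FiniteDimensional F N] [IsSemisimpleModule F[X] N]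
    (h : (smulX F M).charpoly = (smulX F N).charpoly) : Nonempty (M ≃ₗ[F[X]] N) := by
  induction hd : Module.finrank F M using Nat.strong_induction_on generalizing M N with
  | _ d ih =>
    rcases subsingleton_or_nontrivial M with hM | hM
    · have hN := congrArg natDegree h
      rw [LinearMap.charpoly_natDegree, LinearMap.charpoly_natDegree,
        Module.finrank_zero_of_subsingleton, eq_comm, Module.finrank_zero_iff] at hN
      exact ⟨0⟩
    · obtain ⟨S, hS⟩ := IsSemisimpleModule.exists_simple_submodule F[X] M
      obtain ⟨C, hC⟩ := exists_isCompl S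
      have hmul := charpoly_smulX_eq_mul_of_isCompl hC
      obtain ⟨T, hT, hTS⟩ := exists_isSimpleModule_charpoly_smulX_eq
        (irreducible_charpoly_smulX_and_nonempty_equiv F S).1 (LinearMap.charpoly_monic _) N
        (h ▸ hmul ▸ dvd_mul_right _ _)
      obtain ⟨D, hD⟩ := exists_isCompl T
      have hCD : (smulX F C).charpoly = (smulX F D).charpoly := by
        refine mul_left_cancel₀ (LinearMap.charpoly_monic (smulX F S)).ne_zero ?_
        rw [← hmul, h, charpoly_smulX_eq_mul_of_isCompl hD, hTS]
      obtain ⟨e₁⟩ := nonempty_equiv_of_charpoly_smulX_eq_of_isSimpleModule hTS.symm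
      obtain ⟨e₂⟩ := ih _ (hd ▸ finrank_lt_of_isCompl_of_isSimpleModule hC) C D hCD rfl
      exact ⟨(Submodule.prodEquivOfIsCompl S C hC).symm ≪≫ₗ e₁.prodCongr e₂ ≪≫ₗ
        Submodule.prodEquivOfIsCompl T D hD⟩

end Polynomial

/-- Semisimple endomorphisms with the same characteristic polynomial are conjugate. -/
theorem Module.End.IsSemisimple.exists_conj_eq_of_charpoly_eq {F V W : Type*} [Field F]
    [AddCommGroup V] [Module F V] [FiniteDimensional F V]
    [AddCommGroup W] [Module F W] [FiniteDimensional F W]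
    {f : Module.End F V} {g : Module.End F W} (hf : f.IsSemisimple) (hg : g.IsSemisimple)
    (h : f.charpoly = g.charpoly) : ∃ e : V ≃ₗ[F] W, ∀ v, e (f v) = g (e v) := by
  have : IsSemisimpleModule F[X] (Module.AEval' f) := hf
  have : IsSemisimpleModule F[X] (Module.AEval' g) := hg
  have : FiniteDimensional F (Module.AEval' f) := Module.Finite.equiv (Module.AEval'.of f)
  have : FiniteDimensional F (Module.AEval' g) := Module.Finite.equiv (Module.AEval'.of g)
  have hf' : (smulX F (Module.AEval' f)).charpoly = f.charpoly := by
    rw [← LinearEquiv.charpoly_conj (Module.AEval'.of f)]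
    congr 1
    ext x
    simp [LinearEquiv.conj_apply, ← Module.AEval'.X_smul_of]
  have hg' : (smulX F (Module.AEval' g)).charpoly = g.charpoly := by
    rw [← LinearEquiv.charpoly_conj (Module.AEval'.of g)]
    congr 1
    ext x
    simp [LinearEquiv.conj_apply, ← Module.AEval'.X_smul_of]
  obtain ⟨e⟩ := nonempty_equiv_of_charpoly_smulX_eq (F := F) (Module.AEval' f) (Module.AEval' g)
    (hf'.trans (h.trans hg'.symm))
  refine ⟨Module.AEval'.of f ≪≫ₗ e.restrictScalars F ≪≫ₗ (Module.AEval'.of g).symm, fun v ↦ ?_⟩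
  simp [← Module.AEval'.X_smul_of]

theorem RatFunc.eq_zero_of_sum_mul_self_eq_zero {F : Type*} [Field F] [LinearOrder F]
    [IsStrictOrderedRing F] {ι : Type*} [Fintype ι] {f : ι → RatFunc F}
    (h : ∑ i, f i * f i = 0) (i : ι) : f i = 0 := by
  obtain ⟨b, hb⟩ := IsLocalization.exist_integer_multiples_of_finite (nonZeroDivisors F[X]) f
  choose p hp using hb
  have hsum : ∑ i, p i * p i = 0 := by
    apply FaithfulSMul.algebraMap_injective F[X] (RatFunc F)
    simp only [map_sum, map_mul, hp, map_zero, smul_mul_smul_comm, ← Finset.smul_sum, h, smul_zero]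
  have hpi : p i = 0 := by
    refine Polynomial.funext fun x ↦ ?_
    have hx := congrArg (Polynomial.eval x) hsum
    rw [Polynomial.eval_finsetSum, Polynomial.eval_zero,
      Finset.sum_eq_zero_iff_of_nonneg fun j _ ↦ by simpa using mul_self_nonneg _] at hx
    simpa using hx i (Finset.mem_univ i)
  have hbi := hp i
  rw [hpi, map_zero] at hbi
  exact (smul_eq_zero.mp hbi.symm).resolve_left (nonZeroDivisors.ne_zero b.2)

theorem Matrix.IsSymm.eq_zero_of_mul_self_eq_zero {F : Type*} [Field F] [LinearOrder F]
    [IsStrictOrderedRing F] {ι : Type*} [Fintype ι] {A : Matrix ι ι (RatFunc F)}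
    (hA : A.IsSymm) (h : A * A = 0) : A = 0 := by
  ext i j
  refine RatFunc.eq_zero_of_sum_mul_self_eq_zero (f := A i) ?_ j
  have hi := congrFun (congrFun h i) i
  rw [Matrix.mul_apply] at hi
  simpa [hA.apply] using hi

theorem Matrix.IsSymm.aeval {R ι : Type*} [CommRing R] [Fintype ι] [DecidableEq ι]
    {A : Matrix ι ι R} (hA : A.IsSymm) (p : R[X]) : (Polynomial.aeval A p).IsSymm := by
  induction p using Polynomial.induction_on' with
  | add p q hp hq => simpa using hp.add hq
  | monomial n a =>
    rw [aeval_monomial, ← Algebra.smul_def]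
    exact (hA.pow n).smul a

theorem Matrix.IsSymm.isSemisimple_toLin' {F : Type*} [Field F] [LinearOrder F]
    [IsStrictOrderedRing F] {ι : Type*} [Fintype ι] [DecidableEq ι]
    {A : Matrix ι ι (RatFunc F)} (hA : A.IsSymm) : Module.End.IsSemisimple A.toLin' := by
  refine Module.End.isSemisimple_of_squarefree_aeval_eq_zero (p := minpoly (RatFunc F) A) ?_ ?_
  · rintro q ⟨r, hr⟩
    have hzero : Polynomial.aeval A (q * r) = 0 := by
      refine (hA.aeval _).eq_zero_of_mul_self_eq_zero ?_
      rw [← map_mul, show q * r * (q * r) = minpoly (RatFunc F) A * r by rw [hr]; ring, map_mul,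
        minpoly.aeval, zero_mul]
    have hne : q * r ≠ 0 := by
      intro h0
      exact minpoly.ne_zero (Algebra.IsIntegral.isIntegral A) (by rw [hr, mul_assoc, h0, mul_zero])
    have hdvd : q * (q * r) ∣ 1 * (q * r) := by
      rw [← mul_assoc, ← hr, one_mul]
      exact minpoly.dvd _ _ hzero
    exact isUnit_of_dvd_one ((mul_dvd_mul_iff_right hne).mp hdvd)
  · change Polynomial.aeval (Matrix.toLinAlgEquiv' A) _ = 0
    rw [aeval_algHom_apply, minpoly.aeval, map_zero]

/-- Two symmetric matrices over the rational function field `ℚ(μ)` are similar over `ℚ(μ)`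
if and only if they have the same characteristic polynomial `det(tI − K) = det(tI − L)`. -/
theorem symm_matrices_over_ratFunc_similar_iff_same_charpoly
    (n : ℕ) (K L : Matrix (Fin n) (Fin n) (RatFunc ℚ))
    (hK : K.IsSymm) (hL : L.IsSymm) :
    (∃ M : Matrix (Fin n) (Fin n) (RatFunc ℚ), IsUnit M ∧ M⁻¹ * K * M = L) ↔
      K.charpoly = L.charpoly := by
  constructor
  · rintro ⟨_, ⟨U, rfl⟩, rfl⟩
    rw [Matrix.charpoly_units_conj']
  · intro h
    obtain ⟨e, he⟩ := hL.isSemisimple_toLin'.exists_conj_eq_of_charpoly_eq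
      hK.isSemisimple_toLin' (by simpa using h.symm)
    have hM : IsUnit (LinearMap.toMatrix' e.toLinearMap) := by
      refine IsUnit.of_mul_eq_one (LinearMap.toMatrix' e.symm.toLinearMap) ?_
      rw [← LinearMap.toMatrix'_comp, LinearEquiv.comp_symm, LinearMap.toMatrix'_id]
    refine ⟨_, hM, ?_⟩
    have hcomm : K * LinearMap.toMatrix' e.toLinearMap =
        LinearMap.toMatrix' e.toLinearMap * L := by
      apply Matrix.toLin'.injective
      simp only [Matrix.toLin'_mul, Matrix.toLin'_toMatrix']
      exact LinearMap.ext fun v ↦ (he v).symm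
    rw [mul_assoc, hcomm, Matrix.nonsing_inv_mul_cancel_left _ _
      ((Matrix.isUnit_iff_isUnit_det _).mp hM)]
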